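/- Annihilating polynomial for the ideally preconditioned Stokes matrix: assume B has full row rank, so that S = B A⁻¹ Bᵀ is positive definite, let M = [[A, 0],[0, S]] and T = M⁻¹ 𝒜. Then T satisfies the polynomial identity (T − I)(T² − T − I) = 0, where I is the (n_u+n_p)×(n_u+n_p) identity matrix. -/

import Mathlib

open Matrix

/-- A matrix whose rank equals its number of rows has injective left action on vectors. -/
theorem Matrix.vecMul_injective_of_rank_eq_card {m n K : Type*} [Fintype m] [Fintype n] [Field K]
    {B : Matrix m n K} (h : B.rank = Fintype.card m) : Function.Injective B.vecMul := by
  rw [Matrix.vecMul_injective_iff, linearIndependent_iff_card_eq_finrank_span, ← h,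
    Matrix.rank_eq_finrank_span_row, Set.finrank]

/-- If `A` is positive definite and `B` has full row rank, then the Schur complement
`B * A⁻¹ * Bᵀ` is positive definite. -/
theorem Matrix.PosDef.schurComplement_of_rank_eq_card {m n : Type*} [Fintype m] [Fintype n]
    [DecidableEq n] {A : Matrix n n ℝ} (hA : A.PosDef) {B : Matrix m n ℝ}
    (h : B.rank = Fintype.card m) : (B * A⁻¹ * Bᵀ).PosDef := by
  simpa only [conjTranspose_eq_transpose_of_trivial] using
    hA.inv.mul_mul_conjTranspose_same (vecMul_injective_of_rank_eq_card h)

/-- If `Y * X = 1`, then the block matrix `[[1, X], [Y, 0]]` is annihilated by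
`(t - 1) * (t ^ 2 - t - 1)`. -/
theorem Matrix.fromBlocks_one_zero_annihilated {m n R : Type*} [Fintype m] [Fintype n]
    [DecidableEq m] [DecidableEq n] [Ring R] {X : Matrix n m R} {Y : Matrix m n R}
    (h : Y * X = 1) :
    (fromBlocks 1 X Y 0 - 1) * (fromBlocks 1 X Y 0 ^ 2 - fromBlocks 1 X Y 0 - 1) = 0 := by
  have hY : Y * (X * Y) = Y := by rw [← Matrix.mul_assoc, h, Matrix.one_mul]
  rw [← fromBlocks_one, pow_two, fromBlocks_multiply]
  simp [-fromBlocks_one, sub_eq_add_neg, fromBlocks_neg, fromBlocks_add, fromBlocks_multiply, h,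
    Matrix.mul_add, hY]

/-- Annihilating polynomial for the ideally preconditioned Stokes matrix:
with M = [[A,0],[0,S]] and T = M⁻¹ 𝒜, one has (T − I)(T² − T − I) = 0. -/
theorem stmt_7 {nu np : ℕ} (hnu : 0 < nu) (hnp : 0 < np)
    (A : Matrix (Fin nu) (Fin nu) ℝ) (hA : A.PosDef)
    (B : Matrix (Fin np) (Fin nu) ℝ) (hrank : B.rank = np)
    (T : Matrix (Fin nu ⊕ Fin np) (Fin nu ⊕ Fin np) ℝ)
    (hT : T = (fromBlocks A 0 0 (B * A⁻¹ * Bᵀ))⁻¹ *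
      fromBlocks A Bᵀ B (0 : Matrix (Fin np) (Fin np) ℝ)) :
    (T - 1) * (T ^ 2 - T - 1) = 0 := by
  have hAu : IsUnit A := hA.isUnit
  have hSu : IsUnit (B * A⁻¹ * Bᵀ) :=
    (hA.schurComplement_of_rank_eq_card (by simpa using hrank)).isUnit
  have hAdet := (isUnit_iff_isUnit_det A).1 hAu
  have hSdet := (isUnit_iff_isUnit_det _).1 hSu
  have hblocks : T = fromBlocks 1 (A⁻¹ * Bᵀ) ((B * A⁻¹ * Bᵀ)⁻¹ * B) 0 := by
    rw [hT, inv_fromBlocks_zero₂₁_of_isUnit_iff _ _ _ (iff_of_true hAu hSu), fromBlocks_multiply]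
    simp [nonsing_inv_mul _ hAdet]
  rw [hblocks]
  apply fromBlocks_one_zero_annihilated
  rw [Matrix.mul_assoc, ← Matrix.mul_assoc B, nonsing_inv_mul _ hSdet]
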